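/- Let G = (V₁,E₁) be a connected graph with |V₁| ≥ 2 and H = (V₂,E₂) an arbitrary graph with |V₂| ≥ 1, with adjacency matrix A_H. If (i) −2 − ψ_{H*}⁻¹(QEC(G)) ∉ ev(A_H), (ii) min ev(A_H) ≥ −2, and (iii) QEC(G) ≥ 0, then QEC(G⊙H) = ψ_{H*}⁻¹(QEC(G)). -/

import Mathlib

open scoped BigOperators
open Filter Topology
open scoped Classical

namespace QECPaper

/-- The cone (join) `K₁ + H` over a graph `H`: vertex `none` is the apex. -/
def cone {V₂ : Type*} (H : SimpleGraph V₂) : SimpleGraph (Option V₂) where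
  Adj x y := (∃ a b, x = some a ∧ y = some b ∧ H.Adj a b) ∨
    (x = none ∧ y ≠ none) ∨ (x ≠ none ∧ y = none)
  symm := by
    refine ⟨?_⟩
    rintro x y (⟨a, b, rfl, rfl, h⟩ | ⟨rfl, hy⟩ | ⟨hx, rfl⟩)
    · exact Or.inl ⟨b, a, rfl, rfl, h.symm⟩
    · exact Or.inr (Or.inr ⟨hy, rfl⟩)
    · exact Or.inr (Or.inl ⟨rfl, hx⟩)
  loopless := by
    refine ⟨?_⟩
    rintro x (⟨a, b, rfl, hb, h⟩ | ⟨rfl, hy⟩ | ⟨hx, rfl⟩)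
    · exact H.loopless.irrefl a (by cases hb; exact h)
    · exact hy rfl
    · exact hx rfl

/-- The corona `G ⊙ H` of two graphs, realized on `V₁ × ({o} ∪ V₂)`
with `o = none`. -/
def corona {V₁ V₂ : Type*} (G : SimpleGraph V₁) (H : SimpleGraph V₂) :
    SimpleGraph (V₁ × Option V₂) where
  Adj p q := (p.1 = q.1 ∧ (cone H).Adj p.2 q.2) ∨
    (G.Adj p.1 q.1 ∧ p.2 = none ∧ q.2 = none)
  symm := by
    refine ⟨?_⟩
    rintro ⟨i, x⟩ ⟨j, y⟩ (⟨h1, h2⟩ | ⟨h1, h2, h3⟩)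
    · exact Or.inl ⟨h1.symm, (cone H).adj_symm h2⟩
    · exact Or.inr ⟨h1.symm, h3, h2⟩
  loopless := by
    refine ⟨?_⟩
    rintro ⟨i, x⟩ (⟨h1, h2⟩ | ⟨h1, h2, h3⟩)
    · exact (cone H).loopless.irrefl x h2
    · exact G.loopless.irrefl i h1

/-- The quadratic embedding constant of a (connected) graph on a finite vertex set. -/
noncomputable def QEC {V : Type*} [Fintype V] (G : SimpleGraph V) : ℝ :=
  sSup {r : ℝ | ∃ f : V → ℝ, (∑ x, f x ^ 2) = 1 ∧ (∑ x, f x) = 0 ∧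
    r = ∑ x, ∑ y, f x * (G.dist x y : ℝ) * f y}

/-- The set `λ(S)` of `λ` appearing in a solution of the basic equations. -/
def lambdaS {V : Type*} [Fintype V] (G : SimpleGraph V) : Set ℝ :=
  {lam : ℝ | ∃ (f : V → ℝ) (μ : ℝ),
    (∀ x, (∑ y, (G.dist x y : ℝ) * f y) - lam * f x = μ / 2) ∧
    (∑ x, f x) = 0 ∧ (∑ x, f x ^ 2) = 1}

/-- The distance matrix of a graph, with real entries. -/
noncomputable def distMatrix {V : Type*} (G : SimpleGraph V) : Matrix V V ℝ :=
  Matrix.of fun x y => (G.dist x y : ℝ)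

section MatrixFunctions

variable {ι : Type*} [Fintype ι] [DecidableEq ι]

/-- The eigenspace `ker (A - α)` inside `EuclideanSpace ℝ ι`. -/
noncomputable def eigSpace (A : Matrix ι ι ℝ) (α : ℝ) :
    Submodule ℝ (EuclideanSpace ℝ ι) :=
  LinearMap.ker (Matrix.toEuclideanLin A - α • LinearMap.id)

/-- The all-ones vector of `EuclideanSpace ℝ ι`. -/
noncomputable def onesE (ι : Type*) [Fintype ι] : EuclideanSpace ℝ ι :=
  (WithLp.equiv 2 (ι → ℝ)).symm (fun _ => 1)

/-- `‖E_α 𝟏‖²`, where `E_α` is the orthogonal projection of `EuclideanSpace ℝ ι`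
onto the eigenspace `ker (A - α)`. -/
noncomputable def projNormSq (A : Matrix ι ι ℝ) (α : ℝ) : ℝ :=
  ‖(Submodule.orthogonalProjectionOnto (eigSpace A α) (onesE ι) : EuclideanSpace ℝ ι)‖ ^ 2

/-- The set of (real) eigenvalues of a matrix. -/
def evSet (A : Matrix ι ι ℝ) : Set ℝ :=
  {α : ℝ | ∃ v : ι → ℝ, v ≠ 0 ∧ A.mulVec v = α • v}

/-- The set of main eigenvalues: those `α` with `E_α 𝟏 ≠ 0`. -/
def mainEv (A : Matrix ι ι ℝ) : Set ℝ := {α : ℝ | projNormSq A α ≠ 0}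

/-- `k_A = |ev_M(A) \ {-2}|`. -/
noncomputable def kA (A : Matrix ι ι ℝ) : ℕ := (mainEv A \ {(-2 : ℝ)}).ncard

/-- The ω-function associated with the symmetric matrix `A`. -/
noncomputable def omegaFun (A : Matrix ι ι ℝ) (lam : ℝ) : ℝ :=
  1 + projNormSq A (-2) +
    ∑ᶠ α ∈ mainEv A \ {(-2 : ℝ)}, lam / (α + 2 + lam) * projNormSq A α

/-- The (maximal) domain of the ω-function: the complement of its poles. -/
def omegaDomain (A : Matrix ι ι ℝ) : Set ℝ :=
  {lam : ℝ | ∀ α ∈ mainEv A \ {(-2 : ℝ)}, lam ≠ -α - 2}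

/-- The set of zeroes of the ω-function (on its domain). -/
def omegaZeros (A : Matrix ι ι ℝ) : Set ℝ :=
  {lam : ℝ | lam ∈ omegaDomain A ∧ omegaFun A lam = 0}

/-- `λ*`, the largest zero of the ω-function. -/
noncomputable def lamStar (A : Matrix ι ι ℝ) : ℝ := sSup (omegaZeros A)

/-- The ψ-function associated with `A`: `ψ_A(λ) = λ/ω_A(λ)` extended
analytically across the poles of `ω_A` by the value `0`. -/
noncomputable def psiFun (A : Matrix ι ι ℝ) (lam : ℝ) : ℝ :=
  if -lam - 2 ∈ mainEv A \ {(-2 : ℝ)} then 0 else lam / omegaFun A lam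

/-- The inverse of the rightmost branch `ψ_{A*} = ψ_A ↾ (λ*, +∞)`:
`ψ_{A*}⁻¹(y)` is the unique `λ > λ*` with `ψ_A(λ) = y`. -/
noncomputable def psiStarInv (A : Matrix ι ι ℝ) (y : ℝ) : ℝ :=
  sSup {lam : ℝ | lamStar A < lam ∧ psiFun A lam = y}

end MatrixFunctions

/-- The closed form of the distance in `corona G H` in terms of the distance in `G`. -/
noncomputable def coronaDist {V₁ V₂ : Type*} (G : SimpleGraph V₁) (H : SimpleGraph V₂)
    (p q : V₁ × Option V₂) : ℕ :=
  if p.1 = q.1 then (if p.2 = q.2 then 0 else if (cone H).Adj p.2 q.2 then 1 else 2)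
  else G.dist p.1 q.1 + (if p.2 = none then 0 else 1) + (if q.2 = none then 0 else 1)

theorem cone_adj_none_left {V₂ : Type*} (H : SimpleGraph V₂) (x : Option V₂) :
    (cone H).Adj none x ↔ x ≠ none := by
  simp [cone]

theorem cone_adj_none_right {V₂ : Type*} (H : SimpleGraph V₂) (x : Option V₂) :
    (cone H).Adj x none ↔ x ≠ none := by
  simp [cone]

theorem cone_adj_some {V₂ : Type*} (H : SimpleGraph V₂) (a b : V₂) :
    (cone H).Adj (some a) (some b) ↔ H.Adj a b := by
  simp [cone]

theorem coronaDist_le_succ {V₁ V₂ : Type*} {G : SimpleGraph V₁} (hG : G.Connected)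
    (H : SimpleGraph V₂) {p p' : V₁ × Option V₂} (q : V₁ × Option V₂)
    (h : (corona G H).Adj p p') : coronaDist G H p q ≤ coronaDist G H p' q + 1 := by
  obtain ⟨i, x⟩ := p
  obtain ⟨i', x'⟩ := p'
  obtain ⟨j, y⟩ := q
  rcases h with ⟨h1, h2⟩ | ⟨h1, h2, h3⟩
  · dsimp only at h1 h2
    subst h1
    simp only [coronaDist]
    by_cases hxy : x' = y
    · subst hxy
      by_cases hij : i = j
      · simp [hij, h2]
        split_ifs <;> omega
      · simp only [hij, if_false]
        split_ifs <;> omega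
    · split_ifs <;> omega
  · dsimp only at h1 h2 h3
    subst h2 h3
    have htri := hG.dist_triangle (u := i) (v := i') (w := j)
    have hadj : G.dist i i' = 1 := SimpleGraph.dist_eq_one_iff_adj.mpr h1
    have hne : i ≠ i' := h1.ne
    simp only [coronaDist, cone_adj_none_left]
    by_cases hij : i = j
    · by_cases hy : y = none
      · simp [hij, hy]
      · have : ¬ i' = j := fun h => hne (hij.trans h.symm)
        simp [hij, hy, Ne.symm hy, this]
    · by_cases hi'j : i' = j
      · subst hi'j
        by_cases hy : y = none <;> simp [hij, hy, hadj, eq_comm]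
      · simp only [hij, hi'j, if_false]
        split_ifs <;> omega

theorem coronaDist_le_length {V₁ V₂ : Type*} {G : SimpleGraph V₁} (hG : G.Connected)
    (H : SimpleGraph V₂) {p q : V₁ × Option V₂} (w : (corona G H).Walk p q) :
    coronaDist G H p q ≤ w.length := by
  induction w with
  | nil => simp [coronaDist]
  | @cons _ _ q h w ih =>
    have := coronaDist_le_succ hG H q h
    rw [SimpleGraph.Walk.length_cons]
    omega

/-- The embedding of `G` into `corona G H` as the set of apices. -/
def coronaApexHom {V₁ V₂ : Type*} (G : SimpleGraph V₁) (H : SimpleGraph V₂) :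
    G →g corona G H where
  toFun i := (i, none)
  map_rel' h := Or.inr ⟨h, rfl, rfl⟩

theorem corona_adj_apex {V₁ V₂ : Type*} (G : SimpleGraph V₁) (H : SimpleGraph V₂)
    (i : V₁) {x : Option V₂} (hx : x ≠ none) : (corona G H).Adj (i, x) (i, none) :=
  Or.inl ⟨rfl, (cone_adj_none_right H x).mpr hx⟩

theorem corona_reachable_apex {V₁ V₂ : Type*} (G : SimpleGraph V₁) (H : SimpleGraph V₂)
    (i : V₁) (x : Option V₂) : (corona G H).Reachable (i, x) (i, none) := by
  by_cases hx : x = none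
  · rw [hx]
  · exact (corona_adj_apex G H i hx).reachable

theorem corona_connected {V₁ V₂ : Type*} {G : SimpleGraph V₁} (hG : G.Connected)
    (H : SimpleGraph V₂) : (corona G H).Connected := by
  have := hG.nonempty
  refine ⟨?_⟩
  rintro ⟨i, x⟩ ⟨j, y⟩
  exact (corona_reachable_apex G H i x).trans
    (((hG i j).map (coronaApexHom G H)).trans (corona_reachable_apex G H j y).symm)

theorem corona_dist_apex_le {V₁ V₂ : Type*} (G : SimpleGraph V₁) (H : SimpleGraph V₂)
    (i : V₁) (x : Option V₂) :
    (corona G H).dist (i, x) (i, none) ≤ if x = none then 0 else 1 := by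
  by_cases hx : x = none
  · simp [hx]
  · simp [hx, SimpleGraph.dist_eq_one_iff_adj.mpr (corona_adj_apex G H i hx)]

theorem corona_dist {V₁ V₂ : Type*} {G : SimpleGraph V₁} (hG : G.Connected)
    (H : SimpleGraph V₂) (p q : V₁ × Option V₂) :
    (corona G H).dist p q = coronaDist G H p q := by
  have hC := corona_connected hG H
  refine le_antisymm ?_ ?_
  · obtain ⟨i, x⟩ := p
    obtain ⟨j, y⟩ := q
    have hx := corona_dist_apex_le G H i x
    have hy := corona_dist_apex_le G H j y
    rw [SimpleGraph.dist_comm] at hy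
    have h1 := hC.dist_triangle (u := (i, x)) (v := (i, none)) (w := (j, y))
    have h2 := hC.dist_triangle (u := (i, none)) (v := (j, none)) (w := (j, y))
    have h3 : (corona G H).dist (i, none) (j, none) ≤ G.dist i j := by
      obtain ⟨w, hw⟩ := hG.exists_walk_length_eq_dist i j
      rw [← hw, ← SimpleGraph.Walk.length_map (coronaApexHom G H)]
      exact SimpleGraph.dist_le _
    simp only [coronaDist]
    by_cases hij : i = j
    · subst hij
      by_cases hxy : x = y
      · simp [hxy]
      · by_cases hadj : (cone H).Adj x y
        · have : (corona G H).Adj (i, x) (i, y) := Or.inl ⟨rfl, hadj⟩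
          simp [hxy, hadj, SimpleGraph.dist_eq_one_iff_adj.mpr this]
        · simp only [hxy, hadj, if_true, if_false]
          rw [SimpleGraph.dist_self] at h2 h3
          split_ifs at hx hy <;> omega
    · simp only [hij, if_false]
      omega
  · obtain ⟨w, hw⟩ := hC.exists_walk_length_eq_dist p q
    rw [← hw]
    exact coronaDist_le_length hG H w

/-- The quadratic form of the distance matrix. -/
noncomputable def distForm {V : Type*} [Fintype V] (G : SimpleGraph V) (f : V → ℝ) : ℝ :=
  ∑ x, ∑ y, f x * (G.dist x y : ℝ) * f y

theorem corona_dist_cast {V₁ V₂ : Type*} [DecidableEq V₂] {G : SimpleGraph V₁}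
    (hG : G.Connected) (H : SimpleGraph V₂) [DecidableRel H.Adj] (i j : V₁) (x y : Option V₂) :
    ((corona G H).dist (i, x) (j, y) : ℝ) =
      G.dist i j + x.elim 0 (fun _ => 1) + y.elim 0 (fun _ => 1) -
        if i = j then x.elim 0 (fun a => y.elim 0
          (fun b => (H.adjMatrix ℝ + (2 : ℝ) • 1) a b)) else 0 := by
  rw [corona_dist hG]
  by_cases hij : i = j
  · subst hij
    rcases x with _ | a <;> rcases y with _ | b
    · simp [coronaDist]
    · simp [coronaDist, cone_adj_none_left]
    · simp [coronaDist, cone_adj_none_right]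
    · by_cases hab : a = b
      · subst hab
        simp [coronaDist]
        norm_num
      · by_cases hadj : H.Adj a b <;>
          norm_num [coronaDist, cone_adj_some, hab, hadj]
  · rcases x with _ | a <;> rcases y with _ | b <;> simp [coronaDist, hij]

theorem distForm_corona {V₁ V₂ : Type*} [Fintype V₁] [Fintype V₂] [DecidableEq V₂]
    {G : SimpleGraph V₁} (hG : G.Connected) (H : SimpleGraph V₂) [DecidableRel H.Adj]
    (f : V₁ × Option V₂ → ℝ) (hf : ∑ p, f p = 0) :
    distForm (corona G H) f = distForm G (fun i => ∑ x, f (i, x)) -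
      ∑ i, (fun a => f (i, some a)) ⬝ᵥ
        (H.adjMatrix ℝ + (2 : ℝ) • 1).mulVec (fun a => f (i, some a)) := by
  have hterm : ∀ p q : V₁ × Option V₂, f p * ((corona G H).dist p q : ℝ) * f q =
      f p * (G.dist p.1 q.1 : ℝ) * f q + (f p * p.2.elim 0 (fun _ => 1)) * f q
        + f p * (q.2.elim 0 (fun _ => 1) * f q)
        - (if p.1 = q.1 then f p * p.2.elim 0 (fun a => q.2.elim 0
          (fun b => (H.adjMatrix ℝ + (2 : ℝ) • 1) a b)) * f q else 0) := by
    rintro ⟨i, x⟩ ⟨j, y⟩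
    rw [corona_dist_cast hG]
    dsimp only
    split_ifs <;> ring
  simp only [distForm, hterm, Finset.sum_sub_distrib, Finset.sum_add_distrib]
  simp only [← Finset.mul_sum, ← Finset.sum_mul, hf, mul_zero, zero_mul, Finset.sum_const_zero,
    add_zero]
  congr 1
  · simp only [Fintype.sum_prod_type, Finset.sum_mul, Finset.mul_sum]
    refine Finset.sum_congr rfl fun i _ => ?_
    rw [Finset.sum_comm]
    refine Finset.sum_congr rfl fun j _ => ?_
    rw [Finset.sum_comm]
  · simp only [Fintype.sum_prod_type, Fintype.sum_option, Option.elim, dotProduct, Matrix.mulVec,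
      Finset.mul_sum]
    refine Finset.sum_congr rfl fun i _ => ?_
    simp [mul_assoc]

theorem bddAbove_distForm {V : Type*} [Fintype V] (G : SimpleGraph V) :
    BddAbove {r : ℝ | ∃ f : V → ℝ, (∑ x, f x ^ 2) = 1 ∧ (∑ x, f x) = 0 ∧
      r = ∑ x, ∑ y, f x * (G.dist x y : ℝ) * f y} := by
  refine ⟨∑ x, ∑ y, (G.dist x y : ℝ), ?_⟩
  rintro r ⟨f, hf, -, rfl⟩
  have habs : ∀ x, |f x| ≤ 1 := fun x => by
    rw [← sq_le_one_iff_abs_le_one, ← hf]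
    exact Finset.single_le_sum (f := fun x => f x ^ 2) (fun y _ => sq_nonneg _)
      (Finset.mem_univ x)
  refine Finset.sum_le_sum fun x _ => Finset.sum_le_sum fun y _ => ?_
  have hxy : f x * f y ≤ 1 := by
    refine (le_abs_self _).trans ?_
    rw [abs_mul]
    exact mul_le_one₀ (habs x) (abs_nonneg _) (habs y)
  have := mul_le_mul_of_nonneg_right hxy (Nat.cast_nonneg (α := ℝ) (G.dist x y))
  linarith

theorem distForm_le_QEC_mul {V : Type*} [Fintype V] (G : SimpleGraph V) (f : V → ℝ)
    (hf : ∑ x, f x = 0) : distForm G f ≤ QEC G * ∑ x, f x ^ 2 := by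
  rcases (Finset.sum_nonneg fun x (_ : x ∈ Finset.univ) => sq_nonneg (f x)).eq_or_lt with h | h
  · have hzero : ∀ x, f x = 0 := fun x => by
      have := (Finset.sum_eq_zero_iff_of_nonneg fun x _ => sq_nonneg (f x)).mp h.symm x
        (Finset.mem_univ x)
      exact pow_eq_zero_iff two_ne_zero |>.mp this
    simp [distForm, hzero]
  · set N := ∑ x, f x ^ 2 with hN
    have hs : (√N)⁻¹ ^ 2 = N⁻¹ := by rw [inv_pow, Real.sq_sqrt h.le]
    have hmem : N⁻¹ * distForm G f ≤ QEC G := by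
      refine le_csSup (bddAbove_distForm G) ⟨fun x => (√N)⁻¹ * f x, ?_, ?_, ?_⟩
      · simp only [mul_pow, ← Finset.mul_sum, hs]
        exact inv_mul_cancel₀ h.ne'
      · rw [← Finset.mul_sum, hf, mul_zero]
      · simp only [distForm, ← hs, Finset.mul_sum]
        refine Finset.sum_congr rfl fun x _ => Finset.sum_congr rfl fun y _ => ?_
        ring
    rwa [inv_mul_le_iff₀ h, mul_comm] at hmem

theorem exists_unit_sum_eq_zero {V : Type*} [Fintype V] (hV : 2 ≤ Fintype.card V) :
    ∃ f : V → ℝ, (∑ x, f x ^ 2) = 1 ∧ (∑ x, f x) = 0 := by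
  obtain ⟨a, b, hab⟩ := Fintype.exists_pair_of_one_lt_card hV
  have h2 : (√2)⁻¹ ^ 2 = (2 : ℝ)⁻¹ := by rw [inv_pow, Real.sq_sqrt zero_le_two]
  refine ⟨fun x => (√2)⁻¹ * ((if x = a then 1 else 0) - if x = b then 1 else 0), ?_, ?_⟩
  · have : ∀ x, ((√2)⁻¹ * ((if x = a then 1 else 0) - if x = b then 1 else 0)) ^ 2
        = (2 : ℝ)⁻¹ * ((if x = a then 1 else 0) + if x = b then 1 else 0) := fun x => by
      rw [mul_pow, h2]
      by_cases hxa : x = a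
      · simp [hxa, hab]
      · by_cases hxb : x = b
        · simp [hxb, hab.symm]
        · simp [hxa, hxb]
    simp only [this, ← Finset.mul_sum, Finset.sum_add_distrib]
    norm_num
  · simp [← Finset.mul_sum, Finset.sum_sub_distrib]

section Spectral

variable {ι : Type*} [Fintype ι] [DecidableEq ι] {A : Matrix ι ι ℝ}

theorem eigSpace_eq_eigenspace (A : Matrix ι ι ℝ) (α : ℝ) :
    eigSpace A α = Module.End.eigenspace (Matrix.toEuclideanLin A) α := by
  ext v
  simp [eigSpace, sub_eq_zero]

theorem mulVec_of_mem_eigSpace {α : ℝ} {v : EuclideanSpace ℝ ι} (hv : v ∈ eigSpace A α) :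
    A.mulVec v.ofLp = α • v.ofLp := by
  rw [eigSpace_eq_eigenspace, Module.End.mem_eigenspace_iff] at hv
  rw [← WithLp.ofLp_smul, ← hv, Matrix.ofLp_toLpLin, Matrix.toLin'_apply]

theorem projNormSq_eq (A : Matrix ι ι ℝ) (α : ℝ) :
    projNormSq A α = ‖(eigSpace A α).starProjection (onesE ι)‖ ^ 2 := rfl

theorem projNormSq_nonneg (A : Matrix ι ι ℝ) (α : ℝ) : 0 ≤ projNormSq A α :=
  sq_nonneg _

theorem mem_mainEv_iff {α : ℝ} :
    α ∈ mainEv A ↔ (eigSpace A α).starProjection (onesE ι) ≠ 0 := by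
  simp [mainEv, projNormSq_eq]

theorem mainEv_subset_evSet (A : Matrix ι ι ℝ) : mainEv A ⊆ evSet A := fun α hα => by
  refine ⟨_, fun h => mem_mainEv_iff.mp hα ?_,
    mulVec_of_mem_eigSpace (Submodule.starProjection_apply_mem _ (onesE ι))⟩
  exact (WithLp.ofLp_eq_zero 2).mp h

theorem hasEigenvalue_of_mem_mainEv {α : ℝ} (hα : α ∈ mainEv A) :
    Module.End.HasEigenvalue (Matrix.toEuclideanLin A) α := by
  refine Module.End.hasEigenvalue_of_hasEigenvector ⟨?_, mem_mainEv_iff.mp hα⟩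
  rw [← Module.End.eigenspace, ← eigSpace_eq_eigenspace]
  exact Submodule.starProjection_apply_mem _ _

theorem mainEv_finite (A : Matrix ι ι ℝ) : (mainEv A).Finite :=
  (Module.End.finite_hasEigenvalue (Matrix.toEuclideanLin A)).subset
    fun _ => hasEigenvalue_of_mem_mainEv

theorem sum_starProjection_ones (hA : A.IsHermitian) :
    ∑ α ∈ (mainEv_finite A).toFinset, (eigSpace A α).starProjection (onesE ι) = onesE ι := by
  have hT := Matrix.isSymmetric_toEuclideanLin_iff.mpr hA
  have hsum := hT.orthogonalFamily_eigenspaces'.sum_projection_of_mem_iSup (onesE ι)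
    (by rw [Submodule.orthogonal_eq_bot_iff.mp hT.orthogonalComplement_iSup_eigenspaces_eq_bot']
        exact Submodule.mem_top)
  simp only [← eigSpace_eq_eigenspace] at hsum
  conv_rhs => rw [← hsum]
  rw [← Finset.sum_image (s := Finset.univ)
    (g := fun μ : Module.End.Eigenvalues (Matrix.toEuclideanLin A) => (μ : ℝ))
    (f := fun α => (eigSpace A α).starProjection (onesE ι)) (Subtype.val_injective.injOn)]
  refine Finset.sum_subset (fun α hα => ?_) fun α _ hα => ?_
  · rw [Set.Finite.mem_toFinset] at hα
    exact Finset.mem_image.mpr ⟨⟨α, hasEigenvalue_of_mem_mainEv hα⟩, Finset.mem_univ _, rfl⟩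
  · by_contra h
    exact hα ((Set.Finite.mem_toFinset _).mpr (mem_mainEv_iff.mpr h))

theorem omegaFun_eq_sum (A : Matrix ι ι ℝ) (t : ℝ) :
    omegaFun A t = 1 + ∑ α ∈ (mainEv_finite A).toFinset,
      (if α = -2 then 1 else t / (α + 2 + t)) * projNormSq A α := by
  have h1 : ∑ᶠ α ∈ mainEv A \ {(-2 : ℝ)}, t / (α + 2 + t) * projNormSq A α =
      ∑ α ∈ (mainEv_finite A).toFinset.erase (-2), t / (α + 2 + t) * projNormSq A α := by
    rw [← finsum_mem_coe_finset]
    simp [Set.sdiff_eq]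
  rw [omegaFun, h1, add_assoc]
  congr 1
  by_cases h : (-2 : ℝ) ∈ (mainEv_finite A).toFinset
  · rw [← Finset.add_sum_erase _ _ h, if_pos rfl, one_mul]
    congr 1
    refine Finset.sum_congr rfl fun α hα => ?_
    rw [if_neg (Finset.ne_of_mem_erase hα)]
  · have h0 : projNormSq A (-2) = 0 := by simpa [mainEv] using h
    rw [h0, zero_add, Finset.erase_eq_of_notMem h]
    refine Finset.sum_congr rfl fun α hα => ?_
    rw [if_neg fun h' : α = -2 => h (h' ▸ hα)]

theorem sum_eq_inner_onesE {ι : Type*} [Fintype ι] (v : EuclideanSpace ℝ ι) : ∑ a, v a = inner ℝ v (onesE ι) := by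
  simp [onesE, PiLp.inner_apply]

theorem sum_starProjection_apply (A : Matrix ι ι ℝ) (α : ℝ) :
    ∑ a, (eigSpace A α).starProjection (onesE ι) a = projNormSq A α := by
  have h := Submodule.inner_starProjection_left_eq_right (eigSpace A α)
    ((eigSpace A α).starProjection (onesE ι)) (onesE ι)
  rw [Submodule.starProjection_eq_self_iff.mpr (Submodule.starProjection_apply_mem _ _)] at h
  rw [sum_eq_inner_onesE, h, projNormSq_eq, real_inner_self_eq_norm_sq]

/-- For `t ≥ 0` the vector `u = t (A + 2 + t)⁻¹ 1` (suitably interpreted at `t = 0`) satisfies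
`1 + ⟨1, u⟩ = ω_A(t)`. -/
theorem exists_resolvent_vector (hA : A.IsHermitian) (hmin : ∀ β ∈ evSet A, -2 ≤ β) {t : ℝ}
    (ht : 0 ≤ t) : ∃ u : ι → ℝ,
      (A + (2 : ℝ) • 1).mulVec u = (fun a => t - t * u a) ∧ omegaFun A t = 1 + ∑ a, u a := by
  set S := (mainEv_finite A).toFinset
  set P : ℝ → EuclideanSpace ℝ ι := fun α => (eigSpace A α).starProjection (onesE ι) with hP
  set c : ℝ → ℝ := fun α => if α = -2 then 1 else t / (α + 2 + t) with hc
  refine ⟨∑ α ∈ S, c α • (P α).ofLp, ?_, ?_⟩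
  · have hone : ∀ a, ∑ α ∈ S, (P α).ofLp a = 1 := fun a => by
      have := congrArg (fun v : EuclideanSpace ℝ ι => v.ofLp a) (sum_starProjection_ones hA)
      rw [WithLp.ofLp_sum, Finset.sum_apply] at this
      exact this
    have hcoef : ∀ α ∈ S, c α * (α + 2) = t - t * c α := fun α hα => by
      have h2 := hmin α (mainEv_subset_evSet A ((Set.Finite.mem_toFinset _).mp hα))
      simp only [hc]
      split_ifs with h
      · rw [h]; ring
      · have : 0 < α + 2 := by
          rcases h2.lt_or_eq with h' | h'
          · linarith
          · exact absurd h'.symm h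
        field_simp
        ring
    ext a
    rw [Matrix.mulVec_sum, Finset.sum_apply, Finset.sum_apply]
    calc ∑ α ∈ S, ((A + (2 : ℝ) • 1).mulVec (c α • (P α).ofLp)) a
        = ∑ α ∈ S, (c α * (α + 2)) * (P α).ofLp a := by
          refine Finset.sum_congr rfl fun α _ => ?_
          rw [Matrix.mulVec_smul, Matrix.add_mulVec, Matrix.smul_mulVec, Matrix.one_mulVec,
            mulVec_of_mem_eigSpace (Submodule.starProjection_apply_mem _ _)]
          simp only [Pi.smul_apply, Pi.add_apply, smul_eq_mul, hP]
          ring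
      _ = ∑ α ∈ S, (t * (P α).ofLp a - t * (c α * (P α).ofLp a)) := by
          refine Finset.sum_congr rfl fun α hα => ?_
          rw [hcoef α hα]
          ring
      _ = _ := by
          rw [Finset.sum_sub_distrib, ← Finset.mul_sum, ← Finset.mul_sum, hone, mul_one]
          simp
  · rw [omegaFun_eq_sum]
    congr 1
    simp only [Finset.sum_apply, Pi.smul_apply, smul_eq_mul]
    rw [Finset.sum_comm]
    refine Finset.sum_congr rfl fun α _ => ?_
    rw [← Finset.mul_sum, sum_starProjection_apply]

theorem dotProduct_mulVec_nonneg (hA : A.IsHermitian) (hmin : ∀ β ∈ evSet A, -2 ≤ β)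
    (v : ι → ℝ) : 0 ≤ v ⬝ᵥ (A + (2 : ℝ) • 1).mulVec v := by
  have hB : (A + (2 : ℝ) • 1).IsHermitian := hA.add (by simp [Matrix.IsHermitian])
  have hpos : (A + (2 : ℝ) • 1).PosSemidef := by
    refine hB.posSemidef_iff_eigenvalues_nonneg.mpr fun j => ?_
    have hvec := hB.mulVec_eigenvectorBasis j
    have hmem : hB.eigenvalues j - 2 ∈ evSet A := by
      refine ⟨(hB.eigenvectorBasis j).ofLp, fun h => ?_, ?_⟩
      · exact hB.eigenvectorBasis.orthonormal.ne_zero j ((WithLp.ofLp_eq_zero 2).mp h)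
      · rw [Matrix.add_mulVec, Matrix.smul_mulVec, Matrix.one_mulVec] at hvec
        rw [sub_smul, ← hvec, add_sub_cancel_right]
    have := hmin _ hmem
    simp only [Pi.zero_apply]
    linarith
  simpa using hpos.dotProduct_mulVec_nonneg v

/-- Completing the square along the resolvent vector. -/
theorem mul_sq_le_of_resolvent_vector (hA : A.IsHermitian) (hmin : ∀ β ∈ evSet A, -2 ≤ β)
    {t w q : ℝ} (ht : 0 ≤ t) (hw : 0 < w) {u : ι → ℝ}
    (hu : (A + (2 : ℝ) • 1).mulVec u = (fun a => t - t * u a)) (huw : w = 1 + ∑ a, u a)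
    (hq : t = q * w) (s : ℝ) (v : ι → ℝ) :
    q * (s + ∑ a, v a) ^ 2 - v ⬝ᵥ (A + (2 : ℝ) • 1).mulVec v ≤
      t * (s ^ 2 + ∑ a, v a ^ 2) := by
  set B := A + (2 : ℝ) • 1 with hB
  have hBt : B.transpose = B := by
    have : A.transpose = A := by simpa [Matrix.IsHermitian] using hA
    simp [hB, this]
  set c := (s + ∑ a, v a) / w with hc
  have hpsd := dotProduct_mulVec_nonneg hA hmin (v - c • u)
  rw [← hB] at hpsd
  have hsymm : u ⬝ᵥ B.mulVec v = v ⬝ᵥ B.mulVec u := by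
    rw [Matrix.dotProduct_mulVec, ← Matrix.mulVec_transpose, hBt, dotProduct_comm]
  have hvu : ∀ z : ι → ℝ, z ⬝ᵥ B.mulVec u = t * ∑ a, z a - t * ∑ a, z a * u a := fun z => by
    rw [hu, dotProduct, Finset.mul_sum, Finset.mul_sum, ← Finset.sum_sub_distrib]
    exact Finset.sum_congr rfl fun a _ => by ring
  have hexp : (v - c • u) ⬝ᵥ B.mulVec (v - c • u) =
      v ⬝ᵥ B.mulVec v - 2 * c * (v ⬝ᵥ B.mulVec u) + c ^ 2 * (u ⬝ᵥ B.mulVec u) := by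
    simp only [Matrix.mulVec_sub, Matrix.mulVec_smul, sub_dotProduct, dotProduct_sub,
      smul_dotProduct, dotProduct_smul, hsymm, smul_eq_mul]
    ring
  have hsq : 0 ≤ ∑ a, (v a - c * u a) ^ 2 := Finset.sum_nonneg fun a _ => sq_nonneg _
  have hsq' : ∑ a, (v a - c * u a) ^ 2 =
      ∑ a, v a ^ 2 - 2 * c * ∑ a, v a * u a + c ^ 2 * ∑ a, u a * u a := by
    rw [Finset.mul_sum, Finset.mul_sum, ← Finset.sum_sub_distrib, ← Finset.sum_add_distrib]
    exact Finset.sum_congr rfl fun a _ => by ring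
  rw [hexp, hvu, hvu] at hpsd
  rw [hsq'] at hsq
  have hcw : c * w = s + ∑ a, v a := div_mul_cancel₀ _ hw.ne'
  have h1 := mul_nonneg ht hsq
  have h2 := mul_nonneg ht (sq_nonneg (s - c))
  have h3 : q * (s + ∑ a, v a) ^ 2 = t * c * (s + ∑ a, v a) := by
    rw [← hcw, hq]; ring
  have h4 : t * c ^ 2 * (1 + ∑ a, u a) = t * c * (s + ∑ a, v a) := by
    rw [← huw, ← hcw]; ring
  rw [h3]
  linarith

theorem one_le_omegaFun (hmin : ∀ β ∈ evSet A, -2 ≤ β) {t : ℝ} (ht : 0 ≤ t) :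
    1 ≤ omegaFun A t := by
  rw [omegaFun_eq_sum]
  refine le_add_of_nonneg_right (Finset.sum_nonneg fun α hα => ?_)
  have h2 := hmin α (mainEv_subset_evSet A ((Set.Finite.mem_toFinset _).mp hα))
  refine mul_nonneg ?_ (projNormSq_nonneg A α)
  split_ifs
  · exact zero_le_one
  · exact div_nonneg ht (by linarith)

theorem omegaFun_le (hmin : ∀ β ∈ evSet A, -2 ≤ β) {t : ℝ} (ht : 0 ≤ t) :
    omegaFun A t ≤ 1 + ∑ α ∈ (mainEv_finite A).toFinset, projNormSq A α := by
  rw [omegaFun_eq_sum]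
  refine add_le_add_right (Finset.sum_le_sum fun α hα => ?_) 1
  have h2 := hmin α (mainEv_subset_evSet A ((Set.Finite.mem_toFinset _).mp hα))
  refine mul_le_of_le_one_left (projNormSq_nonneg A α) ?_
  split_ifs
  · exact le_rfl
  · exact div_le_one_of_le₀ (by linarith) (by linarith)

theorem continuousOn_omegaFun (hmin : ∀ β ∈ evSet A, -2 ≤ β) :
    ContinuousOn (omegaFun A) (Set.Ici 0) := by
  rw [funext (omegaFun_eq_sum A)]
  refine continuousOn_const.add (continuousOn_finsetSum _ fun α hα => ?_)
  have h2 := hmin α (mainEv_subset_evSet A ((Set.Finite.mem_toFinset _).mp hα))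
  refine ContinuousOn.mul ?_ continuousOn_const
  split_ifs with h
  · exact continuousOn_const
  · refine continuousOn_id.div (continuousOn_const.add continuousOn_id) fun t ht => ?_
    have : -2 < α := lt_of_le_of_ne h2 (Ne.symm h)
    have : (0 : ℝ) ≤ t := ht
    have : 0 < α + 2 + t := by linarith
    exact this.ne'

theorem exists_eq_mul_omegaFun (hmin : ∀ β ∈ evSet A, -2 ≤ β) {q : ℝ} (hq : 0 ≤ q) :
    ∃ t, 0 ≤ t ∧ t = q * omegaFun A t := by
  set C := 1 + ∑ α ∈ (mainEv_finite A).toFinset, projNormSq A α with hC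
  have hC0 : 0 ≤ C :=
    add_nonneg zero_le_one (Finset.sum_nonneg fun α _ => projNormSq_nonneg A α)
  have hqC : 0 ≤ q * C := mul_nonneg hq hC0
  have hcont : ContinuousOn (fun t => t - q * omegaFun A t) (Set.Icc 0 (q * C)) :=
    continuousOn_id.sub (continuousOn_const.mul
      ((continuousOn_omegaFun hmin).mono Set.Icc_subset_Ici_self))
  obtain ⟨t, ht, hzero⟩ := intermediate_value_Icc hqC hcont (show (0 : ℝ) ∈ _ from
    ⟨by linarith [mul_nonneg hq (zero_le_one.trans (one_le_omegaFun hmin le_rfl))],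
      by linarith [mul_le_mul_of_nonneg_left (omegaFun_le hmin hqC) hq]⟩)
  exact ⟨t, ht.1, by linarith [hzero]⟩

theorem lamStar_nonpos (hmin : ∀ β ∈ evSet A, -2 ≤ β) : lamStar A ≤ 0 := by
  refine Real.sSup_nonpos fun t ht => ?_
  by_contra h
  have := one_le_omegaFun hmin (not_le.mp h).le
  linarith [ht.2]

theorem psiFun_of_nonneg (hmin : ∀ β ∈ evSet A, -2 ≤ β) {t : ℝ} (ht : 0 ≤ t) :
    psiFun A t = t / omegaFun A t := by
  refine if_neg fun h => h.2 ?_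
  have := hmin _ (mainEv_subset_evSet A h.1)
  rw [Set.mem_singleton_iff]
  linarith

/-- If `t = q ω_A(t)` has the unique nonnegative solution `t₀`, then `t₀ = ψ_{A*}⁻¹(q)`. -/
theorem psiStarInv_eq (hmin : ∀ β ∈ evSet A, -2 ≤ β) {q t₀ : ℝ} (ht₀ : 0 ≤ t₀)
    (heq : t₀ = q * omegaFun A t₀) (huniq : ∀ t, 0 ≤ t → t = q * omegaFun A t → t = t₀) :
    psiStarInv A q = t₀ := by
  have hub : t₀ ∈ upperBounds {t : ℝ | lamStar A < t ∧ psiFun A t = q} := fun t ht => by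
    rcases le_or_gt 0 t with h | h
    · refine (huniq t h ?_).le
      have hω := one_le_omegaFun hmin h
      rw [← ht.2, psiFun_of_nonneg hmin h, div_mul_cancel₀ _ (by linarith)]
    · exact h.le.trans ht₀
  have hψ : psiFun A t₀ = q := by
    have hω := one_le_omegaFun hmin ht₀
    rw [psiFun_of_nonneg hmin ht₀, div_eq_iff (by linarith), ← heq]
  by_cases hlt : lamStar A < t₀
  · exact IsGreatest.csSup_eq ⟨⟨hlt, hψ⟩, hub⟩
  · have hempty : {t : ℝ | lamStar A < t ∧ psiFun A t = q} = ∅ :=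
      Set.eq_empty_of_forall_notMem fun t ht => hlt (ht.1.trans_le (hub ht))
    rw [psiStarInv, hempty, Real.sSup_empty]
    exact le_antisymm ht₀ ((not_lt.mp hlt).trans (lamStar_nonpos hmin))

end Spectral

theorem QEC_corona_eq {V₁ V₂ : Type*} [Fintype V₁] [Fintype V₂] [DecidableEq V₂]
    {G : SimpleGraph V₁} (H : SimpleGraph V₂) [DecidableRel H.Adj]
    (hG : G.Connected) (hV₁ : 2 ≤ Fintype.card V₁)
    (hmin : ∀ β ∈ evSet (H.adjMatrix ℝ), -2 ≤ β) {t : ℝ} (ht : 0 ≤ t)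
    (heq : t = QEC G * omegaFun (H.adjMatrix ℝ) t) : QEC (corona G H) = t := by
  have hA : (H.adjMatrix ℝ).IsHermitian := H.isHermitian_adjMatrix ℝ
  obtain ⟨u, hu, huw⟩ := exists_resolvent_vector hA hmin ht
  have hω : 0 < omegaFun (H.adjMatrix ℝ) t := zero_lt_one.trans_le (one_le_omegaFun hmin ht)
  set w := omegaFun (H.adjMatrix ℝ) t with hw
  refine le_antisymm (Real.sSup_le ?_ ht) ?_
  · rintro r ⟨f, hf1, hf0, rfl⟩
    change distForm (corona G H) f ≤ t
    have hg0 : ∑ i, ∑ x, f (i, x) = 0 := by rw [← Fintype.sum_prod_type', hf0]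
    rw [distForm_corona hG H f hf0]
    have hG' := distForm_le_QEC_mul G (fun i => ∑ x, f (i, x)) hg0
    refine (sub_le_sub_right hG' _).trans ?_
    rw [Finset.mul_sum, ← Finset.sum_sub_distrib, ← mul_one t, ← hf1, Fintype.sum_prod_type,
      Finset.mul_sum]
    refine Finset.sum_le_sum fun i _ => ?_
    rw [Fintype.sum_option, Fintype.sum_option]
    exact mul_sq_le_of_resolvent_vector hA hmin ht hω hu huw heq _ _
  · set N := 1 + ∑ a, u a ^ 2 with hN
    have hNpos : 0 < N :=
      add_pos_of_pos_of_nonneg one_pos (Finset.sum_nonneg fun a _ => sq_nonneg _)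
    have hform : u ⬝ᵥ (H.adjMatrix ℝ + (2 : ℝ) • 1).mulVec u = t * (w - 1) - t * (N - 1) := by
      rw [hu, huw, hN, dotProduct, add_sub_cancel_left, add_sub_cancel_left, Finset.mul_sum,
        Finset.mul_sum, ← Finset.sum_sub_distrib]
      exact Finset.sum_congr rfl fun a _ => by ring
    have hle : QEC G ≤ (QEC (corona G H) * N + (t * (w - 1) - t * (N - 1))) / w ^ 2 := by
      obtain ⟨g₀, hg₀, hg₀'⟩ := exists_unit_sum_eq_zero hV₁
      refine csSup_le ⟨_, g₀, hg₀, hg₀', rfl⟩ ?_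
      rintro r ⟨g, hg1, hg0, rfl⟩
      change distForm G g ≤ _
      rw [le_div_iff₀ (pow_pos hω 2)]
      set f : V₁ × Option V₂ → ℝ := fun p => g p.1 * p.2.elim 1 u with hf
      have hfsum : ∀ i, ∑ x, f (i, x) = g i * w := fun i => by
        simp only [hf, ← Finset.mul_sum, Fintype.sum_option, Option.elim, huw]
      have hf0 : ∑ p, f p = 0 := by
        rw [Fintype.sum_prod_type]
        simp only [hfsum, ← Finset.sum_mul, hg0, zero_mul]
      have hf2 : ∑ p, f p ^ 2 = N := by
        simp only [hf, Fintype.sum_prod_type, mul_pow, ← Finset.mul_sum, ← Finset.sum_mul, hg1,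
          Fintype.sum_option, Option.elim, hN]
        ring
      have hbound := distForm_le_QEC_mul (corona G H) f hf0
      rw [distForm_corona hG H f hf0, hf2] at hbound
      have h1 : distForm G (fun i => ∑ x, f (i, x)) = distForm G g * w ^ 2 := by
        simp only [hfsum, distForm, Finset.sum_mul]
        exact Finset.sum_congr rfl fun i _ => Finset.sum_congr rfl fun j _ => by ring
      have h2 : ∑ i, (fun a => f (i, some a)) ⬝ᵥ
          (H.adjMatrix ℝ + (2 : ℝ) • 1).mulVec (fun a => f (i, some a)) =
          t * (w - 1) - t * (N - 1) := by
        have : ∀ i, (fun a => f (i, some a)) = g i • u := fun i => rfl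
        simp only [this, Matrix.mulVec_smul, smul_dotProduct, dotProduct_smul, smul_eq_mul, hform]
        simp only [← mul_assoc, ← sq, ← Finset.sum_mul, hg1, one_mul]
      rw [h1, h2] at hbound
      linarith
    rw [le_div_iff₀ (pow_pos hω 2)] at hle
    have hqw : QEC G * w ^ 2 = t * w := by rw [sq, ← mul_assoc, ← heq]
    rw [hqw] at hle
    exact le_of_mul_le_mul_right (by linarith) hNpos

/-- Main formula when `min ev(A_H) ≥ −2` and `QEC(G) ≥ 0`. -/
theorem qec_corona_formula_of_minEv_ge {V₁ V₂ : Type*} [Fintype V₁] [Fintype V₂]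
    [DecidableEq V₂]
    (G : SimpleGraph V₁) (H : SimpleGraph V₂) [DecidableRel H.Adj]
    (hG : G.Connected) (hV₁ : 2 ≤ Fintype.card V₁) (hV₂ : 1 ≤ Fintype.card V₂)
    (hev : -2 - psiStarInv (H.adjMatrix ℝ) (QEC G) ∉ evSet (H.adjMatrix ℝ))
    (hmin : ∀ β ∈ evSet (H.adjMatrix ℝ), -2 ≤ β)
    (hq : 0 ≤ QEC G) :
    QEC (corona G H) = psiStarInv (H.adjMatrix ℝ) (QEC G) := by
  obtain ⟨t, ht, heq⟩ := exists_eq_mul_omegaFun hmin hq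
  have hcorona := QEC_corona_eq H hG hV₁ hmin ht heq
  rw [hcorona]
  refine (psiStarInv_eq hmin ht heq fun s hs hseq => ?_).symm
  rw [← hcorona, QEC_corona_eq H hG hV₁ hmin hs hseq]

end QECPaper
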